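/- arXiv:1204.1683 — 3 statements merged into one kernel-verified Lean document; each statement's English description precedes it below -/
import Mathlib

section
/- Let I be a finite nonempty set and (g_{ij})_{i,j∈I} real numbers satisfying the no-free-loop condition. Then there is no pair (a,φ) consisting of a function a:I→ℝ and a map φ:I→I with φ(i)≠i for all i∈I such that a_i = a_{φ(i)} − g_{i φ(i)} for every i∈I. -/
/- STATEMENT 3: Under the no-free-loop condition there is no "free switching circuit":
no function `a : I → ℝ` and map `φ : I → I` without fixed points can satisfy
`a_i = a_{φ(i)} − g_{i φ(i)}` for every `i`. -/

/-- The no-free-loop condition for a family `(g_{ij})_{i,j∈I}` of real numbers: around any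
cycle `i_1, …, i_p, i_{p+1} = i_1` (`p ≥ 2`, consecutive indices distinct), the sum
`g_{i_1 i_2} + g_{i_2 i_3} + ⋯ + g_{i_p i_1}` is positive. -/
def NoFreeLoop {I : Type*} (g : I → I → ℝ) : Prop :=
  ∀ p : ℕ, 2 ≤ p → ∀ idx : ℕ → I, (∀ l < p, idx (l + 1) ≠ idx l) → idx p = idx 0 →
    0 < ∑ l ∈ Finset.range p, g (idx l) (idx (l + 1))

theorem no_free_switching_circuit {I : Type*} [Fintype I] [Nonempty I]
    (g : I → I → ℝ) (hg : NoFreeLoop g) :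
    ¬ ∃ (a : I → ℝ) (φ : I → I), (∀ i, φ i ≠ i) ∧ ∀ i, a i = a (φ i) - g i (φ i) := by
  rintro ⟨a, φ, hφ, ha⟩
  obtain ⟨i₀⟩ := ‹Nonempty I›
  obtain ⟨m, n, hmn, h⟩ : ∃ m n : ℕ, m < n ∧ φ^[m] i₀ = φ^[n] i₀ := by
    obtain ⟨m, n, hne, h⟩ := Finite.exists_ne_map_eq_of_infinite fun k : ℕ => φ^[k] i₀
    rcases hne.lt_or_gt with hlt | hgt
    · exact ⟨m, n, hlt, h⟩
    · exact ⟨n, m, hgt, h.symm⟩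
  have hstep (l : ℕ) : φ^[l + 1 + m] i₀ = φ (φ^[l + m] i₀) := by
    rw [add_right_comm, Function.iterate_succ_apply']
  have hperiod : φ^[n - m + m] i₀ = φ^[0 + m] i₀ := by
    rw [Nat.sub_add_cancel hmn.le, zero_add, h]
  have hp : 2 ≤ n - m := by
    by_contra! hlt
    have h1 : n - m = 0 + 1 := by omega
    rw [h1, hstep] at hperiod
    exact hφ _ hperiod
  have hpos := hg (n - m) hp (fun l => φ^[l + m] i₀)
    (fun l _ => by simpa only [hstep] using hφ _) hperiod
  have hsum : ∑ l ∈ Finset.range (n - m), g (φ^[l + m] i₀) (φ^[l + 1 + m] i₀) =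
      ∑ l ∈ Finset.range (n - m), (a (φ^[l + 1 + m] i₀) - a (φ^[l + m] i₀)) := by
    refine Finset.sum_congr rfl fun l _ => ?_
    rw [hstep]
    linarith [ha (φ^[l + m] i₀)]
  rw [hsum, Finset.sum_range_sub (fun l => a (φ^[l + m] i₀)), hperiod, sub_self] at hpos
  exact lt_irrefl 0 hpos
end

section
/- Let I be a finite set with at least two elements, let T>0, and for i,j∈I with i≠j let y_i:[0,T]→ℝ and g_{ij}:[0,T]→ℝ be continuous functions such that for every t∈[0,T] the family (g_{ij}(t))_{i,j∈I} satisfies the no-free-loop condition. Then there exist no nondecreasing sequence (t_n)_{n≥1} in [0,T] and no sequence (i_n)_{n≥0} in I with i_{n+1}≠i_n for all n such that y_{i_n}(t_{n+1}) = −g_{i_n i_{n+1}}(t_{n+1}) + y_{i_{n+1}}(t_{n+1}) for every n≥0. (This is the deterministic core of the proof that the optimal switching strategy is admissible, i.e. switches at most finitely many times before T almost surely.) -/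
theorem no_infinite_switching_sequence {I : Type*} [Fintype I]
    (hI : 2 ≤ Fintype.card I) (T : ℝ) (hT : 0 < T)
    (y : I → ℝ → ℝ) (g : I → I → ℝ → ℝ)
    (hy : ∀ i, ContinuousOn (y i) (Set.Icc 0 T))
    (hg : ∀ i j, ContinuousOn (g i j) (Set.Icc 0 T))
    (hnfl : ∀ t ∈ Set.Icc (0 : ℝ) T, NoFreeLoop fun i j => g i j t) :
    ¬ ∃ (t : ℕ → ℝ) (idx : ℕ → I),
        (∀ n, 1 ≤ n → t n ≤ t (n + 1)) ∧
        (∀ n, 1 ≤ n → t n ∈ Set.Icc (0 : ℝ) T) ∧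
        (∀ n, idx (n + 1) ≠ idx n) ∧
        (∀ n, y (idx n) (t (n + 1)) =
          -g (idx n) (idx (n + 1)) (t (n + 1)) + y (idx (n + 1)) (t (n + 1))) := by
  rintro ⟨t, idx, hmono, hmem, hne, hsw⟩
  have hmono' : Monotone fun n => t (n + 1) :=
    monotone_nat_of_le_succ fun n => hmono (n + 1) (by omega)
  have hmem' : ∀ n, t (n + 1) ∈ Set.Icc (0 : ℝ) T := fun n => hmem (n + 1) (by omega)
  obtain ⟨τ, hτ⟩ : ∃ τ, Filter.Tendsto (fun n => t (n + 1)) Filter.atTop (nhds τ) :=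
    ⟨_, tendsto_atTop_ciSup hmono' ⟨T, by rintro _ ⟨n, rfl⟩; exact (hmem' n).2⟩⟩
  have hτmem : τ ∈ Set.Icc (0 : ℝ) T :=
    isClosed_Icc.mem_of_tendsto hτ (Filter.Eventually.of_forall hmem')
  have hτ' : Filter.Tendsto (fun n => t (n + 1)) Filter.atTop
      (nhdsWithin τ (Set.Icc 0 T)) :=
    tendsto_nhdsWithin_iff.2 ⟨hτ, Filter.Eventually.of_forall hmem'⟩
  have hpair : ∀ p : I × I, ∀ᶠ n in Filter.atTop, (idx n, idx (n + 1)) = p →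
      g p.1 p.2 τ = y p.2 τ - y p.1 τ := by
    rintro ⟨a, b⟩
    by_cases hfreq : ∃ᶠ n in Filter.atTop, (idx n, idx (n + 1)) = (a, b)
    · have hlim : Filter.Tendsto
          (fun n => g a b (t (n + 1)) - (y b (t (n + 1)) - y a (t (n + 1))))
          Filter.atTop (nhds (g a b τ - (y b τ - y a τ))) :=
        ((hg a b τ hτmem).sub ((hy b τ hτmem).sub (hy a τ hτmem))).tendsto.comp hτ'
      have hzero : g a b τ - (y b τ - y a τ) ∈ ({0} : Set ℝ) := by
        refine isClosed_singleton.mem_of_frequently_of_tendsto (hfreq.mono fun n hn => ?_) hlim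
        obtain ⟨rfl, rfl⟩ := Prod.mk.inj hn
        have := hsw n
        rw [Set.mem_singleton_iff]
        linarith
      exact Filter.Eventually.of_forall fun _ _ => sub_eq_zero.1 hzero
    · exact (Filter.not_frequently.1 hfreq).mono fun n hn h => absurd h hn
  obtain ⟨N, hN⟩ := Filter.eventually_atTop.1 (Filter.eventually_all.2 hpair)
  have hstep : ∀ n, N ≤ n →
      g (idx n) (idx (n + 1)) τ = y (idx (n + 1)) τ - y (idx n) τ :=
    fun n hn => hN n hn _ rfl
  obtain ⟨m, k, hmk, heq⟩ : ∃ m k, m < k ∧ idx (N + m) = idx (N + k) := by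
    obtain ⟨m, k, hmk, heq⟩ := Finite.exists_ne_map_eq_of_infinite fun n => idx (N + n)
    rcases lt_or_gt_of_ne hmk with h | h
    · exact ⟨m, k, h, heq⟩
    · exact ⟨k, m, h, heq.symm⟩
  obtain ⟨p, rfl⟩ := Nat.exists_eq_add_of_lt hmk
  rw [show N + (m + p + 1) = N + m + (p + 1) by ring] at heq
  have hp : 2 ≤ p + 1 := by
    by_contra! h
    obtain rfl : p = 0 := by omega
    exact hne (N + m) heq.symm
  have hpos := hnfl τ hτmem (p + 1) hp (fun l => idx (N + m + l))
    (fun l _ => hne (N + m + l)) heq.symm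
  refine hpos.ne' ?_
  calc ∑ l ∈ Finset.range (p + 1), g (idx (N + m + l)) (idx (N + m + (l + 1))) τ
      = ∑ l ∈ Finset.range (p + 1),
          (y (idx (N + m + (l + 1))) τ - y (idx (N + m + l)) τ) :=
        Finset.sum_congr rfl fun l _ => hstep (N + m + l) (by omega)
    _ = y (idx (N + m + (p + 1))) τ - y (idx (N + m + 0)) τ :=
        Finset.sum_range_sub (fun l => y (idx (N + m + l)) τ) (p + 1)
    _ = 0 := sub_eq_zero.2 (congrArg (fun i => y i τ) heq.symm)
end

section
/- Let I be a finite nonempty set, (g_{ij})_{i,j∈I} real numbers satisfying the no-free-loop condition, and u,w:I→ℝ. Let Ĩ := {k∈I : u_k − w_k = max_{i∈I}(u_i − w_i)} (which is nonempty). Assume that for every k∈Ĩ and every j∈I with j≠k, w_k ≥ w_j − g_{kj}. Then there exists k∈Ĩ such that u_k > u_j − g_{kj} for every j∈I with j≠k. (This is the key claim in the proof of the comparison/uniqueness theorem for the system of variational inequalities.) -/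
/-- Under the no-free-loop condition, a finite nonempty set `S` cannot have the property that
each `k ∈ S` has a distinct `j ∈ S` with `g k j ≤ u j - u k`: following such successors would
close a loop of nonpositive total cost. -/
theorem NoFreeLoop.exists_forall_sub_lt {I : Type*} [Finite I] {g : I → I → ℝ}
    (hg : NoFreeLoop g) (u : I → ℝ) {S : Set I} (hS : S.Nonempty) :
    ∃ k ∈ S, ∀ j ∈ S, j ≠ k → u j - g k j < u k := by
  by_contra! h
  choose! f hfS hfne hfle using h
  obtain ⟨k, hk⟩ := hS
  have hmem (n : ℕ) : f^[n] k ∈ S := by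
    induction n with
    | zero => exact hk
    | succ n ih => rw [Function.iterate_succ_apply']; exact hfS _ ih
  have hne (n : ℕ) : f^[n + 1] k ≠ f^[n] k := by
    rw [Function.iterate_succ_apply']
    exact hfne _ (hmem n)
  have hle (n : ℕ) : g (f^[n] k) (f^[n + 1] k) ≤ u (f^[n + 1] k) - u (f^[n] k) := by
    rw [Function.iterate_succ_apply']
    linarith [hfle _ (hmem n)]
  obtain ⟨a, b, hab, heq⟩ : ∃ a b : ℕ, a < b ∧ f^[a] k = f^[b] k := by
    obtain ⟨a, b, hne', heq⟩ := Finite.exists_ne_map_eq_of_infinite fun n : ℕ => f^[n] k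
    rcases hne'.lt_or_gt with h | h
    · exact ⟨a, b, h, heq⟩
    · exact ⟨b, a, h, heq.symm⟩
  have hb : b ≠ a + 1 := by
    rintro rfl
    exact hne a heq.symm
  have hclose : f^[a + (b - a)] k = f^[a] k := by
    rw [Nat.add_sub_cancel' hab.le, heq]
  have hpos := hg (b - a) (by omega) (fun l => f^[a + l] k) (fun l _ => hne (a + l)) hclose
  refine hpos.not_ge ((Finset.sum_le_sum fun l _ => hle (a + l)).trans_eq ?_)
  simp_rw [add_assoc]
  rw [Finset.sum_range_sub (fun l => u (f^[a + l] k)), hclose, add_zero, sub_self]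

theorem strict_obstacle_on_argmax {I : Type*} [Fintype I] [Nonempty I]
    (g : I → I → ℝ) (hg : NoFreeLoop g) (u w : I → ℝ)
    (hsuper : ∀ k : I,
      (u k - w k = Finset.univ.sup' Finset.univ_nonempty fun i => u i - w i) →
      ∀ j : I, j ≠ k → w j - g k j ≤ w k) :
    ∃ k : I,
      (u k - w k = Finset.univ.sup' Finset.univ_nonempty fun i => u i - w i) ∧
      ∀ j : I, j ≠ k → u j - g k j < u k := by
  obtain ⟨m, -, hm⟩ := Finset.exists_mem_eq_sup' Finset.univ_nonempty fun i => u i - w i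
  obtain ⟨k, hk, hlt⟩ := hg.exists_forall_sub_lt u
    (S := {k | u k - w k = Finset.univ.sup' Finset.univ_nonempty fun i => u i - w i})
    ⟨m, hm.symm⟩
  refine ⟨k, hk, fun j hjk => ?_⟩
  by_contra! hle
  refine hle.not_gt (hlt j (le_antisymm ?_ ?_) hjk)
  · exact Finset.le_sup' (fun i => u i - w i) (Finset.mem_univ j)
  · rw [← show u k - w k = _ from hk]
    linarith [hsuper k hk j hjk]
end
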